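/- arXiv:1602.05038 — 5 statements merged into one kernel-verified Lean document; each statement's English description precedes it below -/
import Mathlib

section
/- For every finite simple graph G and every spectrum of k ≥ 2 colors endowed with a symmetric nonnegative k×k interference matrix W, there exists a W-balanced k-coloring of G, i.e., a coloring c : V(G) → {1,…,k} such that for every vertex v and every color j ∈ {1,…,k}, the interference I_v(c) = Σ_{u ∈ N(v)} W(c(u), c(v)) is at most the potential interference I_v^j(c) = Σ_{u ∈ N(v)} W(c(u), j). -/
open Finset

/-- The total interference of a coloring splits into twice the interference at `v` and the total
interference among the remaining vertices. -/
theorem sum_interference_eq {V K : Type*} [Fintype V] [DecidableEq V] (G : SimpleGraph V)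
    [DecidableRel G.Adj] (W : K → K → ℝ) (hsymm : ∀ i j, W i j = W j i) (c : V → K) (v : V) :
    ∑ x, ∑ y ∈ G.neighborFinset x, W (c y) (c x) =
      2 * ∑ u ∈ G.neighborFinset v, W (c u) (c v) +
        ∑ x ∈ univ.erase v, ∑ y ∈ (G.neighborFinset x).erase v, W (c y) (c x) := by
  have hsplit : ∀ x, ∑ y ∈ G.neighborFinset x, W (c y) (c x) =
      (if G.Adj v x then W (c x) (c v) else 0) +
        ∑ y ∈ (G.neighborFinset x).erase v, W (c y) (c x) := by
    intro x
    split_ifs with h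
    · rw [hsymm (c x) (c v), add_sum_erase _ (fun y => W (c y) (c x)) (by simpa using h.symm)]
    · rw [erase_eq_of_notMem (by simpa [G.adj_comm] using h), zero_add]
  have hnbr : ∑ x ∈ univ.erase v, (if G.Adj v x then W (c x) (c v) else 0) =
      ∑ u ∈ G.neighborFinset v, W (c u) (c v) := by
    rw [← sum_filter]
    refine sum_congr ?_ fun _ _ => rfl
    ext x
    simpa using fun h : G.Adj v x => h.ne'
  rw [← add_sum_erase univ _ (mem_univ v), sum_congr rfl fun x _ => hsplit x, sum_add_distrib,
    hnbr]
  ring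

/-- For every finite simple graph `G` and every spectrum of `k ≥ 2` colors endowed with a
symmetric nonnegative interference matrix `W`, there exists a `W`-balanced `k`-coloring of `G`. -/
theorem exists_balanced_coloring {V : Type*} [Fintype V] (G : SimpleGraph V)
    [DecidableRel G.Adj] (k : ℕ) (hk : 2 ≤ k) (W : Fin k → Fin k → ℝ)
    (hsymm : ∀ i j, W i j = W j i) (hnonneg : ∀ i j, 0 ≤ W i j) :
    ∃ c : V → Fin k, ∀ v : V, ∀ j : Fin k,
      ∑ u ∈ G.neighborFinset v, W (c u) (c v) ≤ ∑ u ∈ G.neighborFinset v, W (c u) j := by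
  classical
  have : Nonempty (Fin k) := ⟨⟨0, by omega⟩⟩
  obtain ⟨c, hc⟩ := Finite.exists_min
    fun c : V → Fin k => ∑ x, ∑ y ∈ G.neighborFinset x, W (c y) (c x)
  refine ⟨c, fun v j => ?_⟩
  have hmin := hc (Function.update c v j)
  have hnbr : ∑ u ∈ G.neighborFinset v,
      W (Function.update c v j u) (Function.update c v j v) =
        ∑ u ∈ G.neighborFinset v, W (c u) j := by
    refine sum_congr rfl fun u hu => ?_
    rw [Function.update_self,
      Function.update_of_ne ((G.mem_neighborFinset _ _).1 hu).ne']
  have hrest : ∑ x ∈ univ.erase v, ∑ y ∈ (G.neighborFinset x).erase v,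
      W (Function.update c v j y) (Function.update c v j x) =
        ∑ x ∈ univ.erase v, ∑ y ∈ (G.neighborFinset x).erase v, W (c y) (c x) := by
    refine sum_congr rfl fun x hx => sum_congr rfl fun y hy => ?_
    rw [Function.update_of_ne (ne_of_mem_erase hx), Function.update_of_ne (ne_of_mem_erase hy)]
  simp only [sum_interference_eq G W hsymm _ v, hnbr, hrest] at hmin
  linarith
end

section
/- Let G be a finite simple graph and W a symmetric nonnegative k×k interference matrix on a spectrum of k colors. If a coloring c : V(G) → {1,…,k} minimizes the sum of edge-interferences I(c) = Σ_{uv ∈ E(G)} W(c(u), c(v)) over all k-colorings of G, then c is W-balanced. -/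
open Finset

/-- A sum over the edges splits into the edges avoiding `v` and the edges from `v` to its
neighbours. -/
theorem SimpleGraph.sum_edgeFinset_eq_add_sum_neighborFinset {V M : Type*} [Fintype V]
    [DecidableEq V] [AddCommMonoid M] (G : SimpleGraph V) [DecidableRel G.Adj] (v : V)
    (f : Sym2 V → M) :
    ∑ e ∈ G.edgeFinset, f e =
      ∑ e ∈ G.edgeFinset with v ∉ e, f e + ∑ u ∈ G.neighborFinset v, f s(u, v) := by
  have himage : G.edgeFinset.filter (v ∈ ·) = (G.neighborFinset v).image (s(·, v)) := by
    ext e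
    induction e with | _ a b
    simp only [mem_filter, SimpleGraph.mem_edgeFinset, SimpleGraph.mem_edgeSet, Sym2.mem_iff,
      mem_image, SimpleGraph.mem_neighborFinset, Sym2.eq_iff]
    constructor
    · rintro ⟨hab, rfl | rfl⟩
      · exact ⟨b, hab, Or.inr ⟨rfl, rfl⟩⟩
      · exact ⟨a, hab.symm, Or.inl ⟨rfl, rfl⟩⟩
    · rintro ⟨u, hu, ⟨rfl, rfl⟩ | ⟨rfl, rfl⟩⟩
      · exact ⟨hu.symm, Or.inr rfl⟩
      · exact ⟨hu, Or.inl rfl⟩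
  rw [← sum_filter_add_sum_filter_not G.edgeFinset (v ∈ ·), add_comm, himage,
    sum_image fun _ _ _ _ h => Sym2.congr_left.1 h]

/-- If a coloring minimizes the sum of edge-interferences over all `k`-colorings of `G`,
then it is `W`-balanced. -/
theorem minimizer_is_balanced {V : Type*} [Fintype V] [DecidableEq V] (G : SimpleGraph V)
    [DecidableRel G.Adj] (k : ℕ) (W : Fin k → Fin k → ℝ)
    (hsymm : ∀ i j, W i j = W j i) (hnonneg : ∀ i j, 0 ≤ W i j)
    (c : V → Fin k)
    (hmin : ∀ c' : V → Fin k,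
      ∑ e ∈ G.edgeFinset, Sym2.lift ⟨fun u w => W (c u) (c w), fun u w => hsymm (c u) (c w)⟩ e ≤
      ∑ e ∈ G.edgeFinset,
        Sym2.lift ⟨fun u w => W (c' u) (c' w), fun u w => hsymm (c' u) (c' w)⟩ e) :
    ∀ v : V, ∀ j : Fin k,
      ∑ u ∈ G.neighborFinset v, W (c u) (c v) ≤ ∑ u ∈ G.neighborFinset v, W (c u) j := by
  intro v j
  have h := hmin (Function.update c v j)
  rw [G.sum_edgeFinset_eq_add_sum_neighborFinset v,
    G.sum_edgeFinset_eq_add_sum_neighborFinset v] at h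
  have havoid : ∀ e ∈ G.edgeFinset.filter (v ∉ ·),
      Sym2.lift ⟨fun u w => W (Function.update c v j u) (Function.update c v j w),
        fun u w => hsymm (Function.update c v j u) (Function.update c v j w)⟩ e =
      Sym2.lift ⟨fun u w => W (c u) (c w), fun u w => hsymm (c u) (c w)⟩ e := by
    intro e he
    induction e with | _ a b
    simp only [mem_filter, Sym2.mem_iff, not_or] at he
    simp [Function.update_of_ne (Ne.symm he.2.1), Function.update_of_ne (Ne.symm he.2.2)]
  have hneighbor : ∀ u ∈ G.neighborFinset v,
      W (Function.update c v j u) (Function.update c v j v) = W (c u) j := by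
    intro u hu
    rw [SimpleGraph.mem_neighborFinset] at hu
    rw [Function.update_self, Function.update_of_ne hu.ne']
  rw [sum_congr rfl havoid] at h
  simp only [Sym2.lift_mk] at h
  rw [sum_congr rfl hneighbor] at h
  exact le_of_add_le_add_left h
end

section
/- Any W-balanced k-coloring c of a finite simple graph G satisfies, for every vertex v, the inequality k · I_v(c) ≤ deg(v) · ||W||_∞, where deg(v) is the degree of v and ||W||_∞ = max_i Σ_j W_ij is the natural (maximum row-sum) norm of W. -/
open Finset

/-- Any `W`-balanced `k`-coloring `c` of a finite simple graph `G` satisfies, for every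
vertex `v`, the inequality `k · I_v(c) ≤ deg(v) · ‖W‖_∞`, where `‖W‖_∞` is the maximum
row-sum norm of `W`. -/
theorem balanced_interference_bound {V : Type*} [Fintype V] (G : SimpleGraph V)
    [DecidableRel G.Adj] (k : ℕ) (W : Fin k → Fin k → ℝ)
    (hsymm : ∀ i j, W i j = W j i) (hnonneg : ∀ i j, 0 ≤ W i j)
    (normW : ℝ) (hnormW : IsGreatest (Set.range fun i : Fin k => ∑ j, W i j) normW)
    (c : V → Fin k)
    (hbal : ∀ v : V, ∀ j : Fin k,
      ∑ u ∈ G.neighborFinset v, W (c u) (c v) ≤ ∑ u ∈ G.neighborFinset v, W (c u) j)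
    (v : V) :
    (k : ℝ) * ∑ u ∈ G.neighborFinset v, W (c u) (c v) ≤ (G.degree v : ℝ) * normW := by
  calc
    (k : ℝ) * ∑ u ∈ G.neighborFinset v, W (c u) (c v)
      = ∑ _j : Fin k, ∑ u ∈ G.neighborFinset v, W (c u) (c v) := by simp
    _ ≤ ∑ j : Fin k, ∑ u ∈ G.neighborFinset v, W (c u) j :=
        Finset.sum_le_sum fun j _ => hbal v j
    _ = ∑ u ∈ G.neighborFinset v, ∑ j : Fin k, W (c u) j := Finset.sum_comm
    _ ≤ ∑ _u ∈ G.neighborFinset v, normW :=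
        Finset.sum_le_sum fun u _ => hnormW.2 ⟨c u, rfl⟩
    _ = (G.degree v : ℝ) * normW := by simp
end

section
/- Theorem (upper bound for the Threshold Spectrum Coloring problem): Let G be a finite simple graph and W a symmetric nonnegative k×k interference matrix with k ≥ 2. Then there exists a k-coloring c : V(G) → {1,…,k} such that for every vertex v the interference satisfies I_v(c) ≤ Δ(G) · ||W||_∞ / k, where Δ(G) is the maximum vertex degree of G. In particular, the minimum k-chromatic threshold T_k(G,W) (the minimum over all k-colorings of the maximum vertex interference) satisfies T_k(G,W) ≤ Δ(G) · ||W||_∞ / k. -/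
open Finset

/-- Split a symmetric double sum with vanishing diagonal term at `v` into the part touching `v`
and the part avoiding `v`. -/
theorem sum_sum_eq_two_mul_add_sum_erase {V : Type*} [Fintype V] [DecidableEq V]
    (f : V → V → ℝ) (hf : ∀ x y, f x y = f y x) (v : V) (hv : f v v = 0) :
    ∑ x, ∑ y, f x y =
      2 * ∑ y, f v y + ∑ x ∈ univ.erase v, ∑ y ∈ univ.erase v, f x y := by
  have hrow : ∀ x, ∑ y, f x y = f v x + ∑ y ∈ univ.erase v, f x y := fun x => by
    rw [← Finset.add_sum_erase _ _ (mem_univ v), hf x v]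
  have herase : ∑ x ∈ univ.erase v, f v x = ∑ y, f v y := by
    rw [← Finset.add_sum_erase _ (f v) (mem_univ v), hv, zero_add]
  rw [← Finset.add_sum_erase _ _ (mem_univ v), Finset.sum_congr rfl fun x _ => hrow x,
    Finset.sum_add_distrib, herase]
  ring

/-- For symmetric interferences there is a coloring in which no vertex can lower its
interference by changing its own color. -/
theorem exists_coloring_forall_interference_le {V C : Type*} [Fintype V] [Finite C] [Nonempty C]
    (G : SimpleGraph V) [DecidableRel G.Adj] (W : C → C → ℝ) (hsymm : ∀ i j, W i j = W j i) :
    ∃ c : V → C, ∀ v j,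
      ∑ u ∈ G.neighborFinset v, W (c u) (c v) ≤ ∑ u ∈ G.neighborFinset v, W (c u) j := by
  classical
  let f : (V → C) → V → V → ℝ := fun c x y => if G.Adj x y then W (c y) (c x) else 0
  obtain ⟨c, hc⟩ := Finite.exists_min fun c : V → C => ∑ x, ∑ y, f c x y
  have hf : ∀ c x y, f c x y = f c y x := fun c x y => by
    simp only [f, G.adj_comm x y, hsymm (c y) (c x)]
  have hdiag : ∀ c v, f c v v = 0 := fun c v => by simp [f]
  refine ⟨c, fun v j => ?_⟩
  have hmin := hc (Function.update c v j)
  rw [sum_sum_eq_two_mul_add_sum_erase _ (hf _) v (hdiag _ v),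
    sum_sum_eq_two_mul_add_sum_erase _ (hf _) v (hdiag _ v)] at hmin
  have hrest : ∑ x ∈ univ.erase v, ∑ y ∈ univ.erase v, f (Function.update c v j) x y =
      ∑ x ∈ univ.erase v, ∑ y ∈ univ.erase v, f c x y :=
    Finset.sum_congr rfl fun x hx => Finset.sum_congr rfl fun y hy => by
      simp only [f, Function.update_of_ne (ne_of_mem_erase hx),
        Function.update_of_ne (ne_of_mem_erase hy)]
  have hold : ∑ y, f c v y = ∑ u ∈ G.neighborFinset v, W (c u) (c v) := by
    rw [G.neighborFinset_eq_filter, Finset.sum_filter]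
  have hnew : ∑ y, f (Function.update c v j) v y = ∑ u ∈ G.neighborFinset v, W (c u) j := by
    rw [G.neighborFinset_eq_filter, Finset.sum_filter]
    refine Finset.sum_congr rfl fun y _ => ?_
    by_cases h : G.Adj v y
    · simp [f, h, Function.update_of_ne h.ne']
    · simp [f, h]
  linarith

/-- Upper bound for the Threshold Spectrum Coloring problem: there is a `k`-coloring whose
interference at every vertex is at most `Δ(G) · ‖W‖_∞ / k`; in particular the minimum
`k`-chromatic threshold `T_k(G,W)` is at most `Δ(G) · ‖W‖_∞ / k`. -/
theorem TSC_upper_bound {V : Type*} [Fintype V] (G : SimpleGraph V)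
    [DecidableRel G.Adj] (k : ℕ) (hk : 2 ≤ k) (W : Fin k → Fin k → ℝ)
    (hsymm : ∀ i j, W i j = W j i) (hnonneg : ∀ i j, 0 ≤ W i j)
    (normW : ℝ) (hnormW : IsGreatest (Set.range fun i : Fin k => ∑ j, W i j) normW) :
    (∃ c : V → Fin k, ∀ v : V,
        ∑ u ∈ G.neighborFinset v, W (c u) (c v) ≤ (G.maxDegree : ℝ) * normW / k) ∧
      sInf {t : ℝ | 0 ≤ t ∧ ∃ c : V → Fin k, ∀ v : V,
          ∑ u ∈ G.neighborFinset v, W (c u) (c v) ≤ t} ≤ (G.maxDegree : ℝ) * normW / k := by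
  have hk0 : 0 < k := by omega
  have : Nonempty (Fin k) := ⟨⟨0, hk0⟩⟩
  have hkR : (0 : ℝ) < k := by exact_mod_cast hk0
  have hrow : ∀ i, ∑ j, W i j ≤ normW := fun i => hnormW.2 ⟨i, rfl⟩
  have hnorm : 0 ≤ normW :=
    (Finset.sum_nonneg fun j _ => hnonneg ⟨0, hk0⟩ j).trans (hrow ⟨0, hk0⟩)
  obtain ⟨c, hc⟩ := exists_coloring_forall_interference_le G W hsymm
  have hbound : ∀ v : V,
      ∑ u ∈ G.neighborFinset v, W (c u) (c v) ≤ (G.maxDegree : ℝ) * normW / k := fun v => by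
    rw [le_div_iff₀ hkR]
    calc (∑ u ∈ G.neighborFinset v, W (c u) (c v)) * k
        = ∑ _j : Fin k, ∑ u ∈ G.neighborFinset v, W (c u) (c v) := by
          simp [mul_comm]
      _ ≤ ∑ j : Fin k, ∑ u ∈ G.neighborFinset v, W (c u) j :=
          Finset.sum_le_sum fun j _ => hc v j
      _ = ∑ u ∈ G.neighborFinset v, ∑ j : Fin k, W (c u) j := Finset.sum_comm
      _ ≤ ∑ _u ∈ G.neighborFinset v, normW := Finset.sum_le_sum fun u _ => hrow (c u)
      _ = (G.degree v : ℝ) * normW := by simp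
      _ ≤ (G.maxDegree : ℝ) * normW := by
          gcongr
          exact G.degree_le_maxDegree v
  exact ⟨⟨c, hbound⟩, csInf_le ⟨0, fun t ht => ht.1⟩ ⟨by positivity, c, hbound⟩⟩
end

section
/- Theorem (Chromatic Spectrum Coloring bound, non-multiple threshold case): Let G be a finite simple graph, W a symmetric nonnegative s×s interference matrix on a spectrum of s ≥ 2 colors, and d > 0 a common divisor of all entries of W. Let t ≥ 0 be any real number (not necessarily a multiple of d) such that d·⌊t/d⌋ ≥ (Δ(G)·||W||_∞ − d·(s−1))/s. Then, setting k₀ = ⌈(Δ(G)·||W||_∞ + d)/(d·⌊t/d⌋ + d)⌉, we have k₀ ≤ s and there exists a coloring c : V(G) → {1,…,k₀} such that I_v(c) ≤ t for every vertex v; hence χ_t(G,W) ≤ ⌈(Δ(G)·||W||_∞ + d)/(d·⌊t/d⌋ + d)⌉. -/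
open Finset

/-- A symmetric double sum with vanishing diagonal entry at `a`, split into the row and column
of `a` and the rest. -/
theorem sum_sum_eq_two_mul_row_add {V : Type*} [Fintype V] [DecidableEq V] (f : V → V → ℝ)
    (hf : ∀ u v, f u v = f v u) (a : V) (ha : f a a = 0) :
    ∑ v, ∑ u, f v u =
      2 * ∑ u, f a u + ∑ v ∈ univ.erase a, ∑ u ∈ univ.erase a, f v u := by
  have hrow : ∀ v, ∑ u, f v u = f v a + ∑ u ∈ univ.erase a, f v u := fun v =>
    (add_sum_erase univ (f v) (mem_univ a)).symm
  have hcol : ∑ v ∈ univ.erase a, f v a = ∑ u, f a u := by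
    rw [hrow a, ha, zero_add]
    exact sum_congr rfl fun v _ => hf v a
  rw [← add_sum_erase univ (fun v => ∑ u, f v u) (mem_univ a),
    sum_congr rfl fun v _ => hrow v, sum_add_distrib, hcol]
  ring

/-- For symmetric interferences there is a coloring in which no vertex can lower its own
interference by changing its color. -/
theorem SimpleGraph.exists_coloring_locally_optimal {V K : Type*} [Fintype V] [Finite K]
    [Nonempty K] (G : SimpleGraph V) [DecidableRel G.Adj] (W : K → K → ℝ)
    (hW : ∀ i j, W i j = W j i) :
    ∃ c : V → K, ∀ v i,
      ∑ u ∈ G.neighborFinset v, W (c u) (c v) ≤ ∑ u ∈ G.neighborFinset v, W (c u) i := by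
  classical
  let f : (V → K) → V → V → ℝ := fun c v u => if G.Adj v u then W (c u) (c v) else 0
  have hf : ∀ c u v, f c u v = f c v u := fun c u v => by
    simp only [f, G.adj_comm u v, hW (c u) (c v)]
  have hdiag : ∀ c v, f c v v = 0 := fun c v => by simp [f]
  obtain ⟨c, hc⟩ := Finite.exists_min fun c : V → K => ∑ v, ∑ u, f c v u
  refine ⟨c, fun v i => ?_⟩
  have hmin := hc (Function.update c v i)
  rw [sum_sum_eq_two_mul_row_add _ (hf _) v (hdiag _ v),
    sum_sum_eq_two_mul_row_add _ (hf _) v (hdiag _ v)] at hmin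
  have hrest : ∑ x ∈ univ.erase v, ∑ u ∈ univ.erase v, f (Function.update c v i) x u =
      ∑ x ∈ univ.erase v, ∑ u ∈ univ.erase v, f c x u := by
    refine sum_congr rfl fun x hx => sum_congr rfl fun u hu => ?_
    simp only [f, Function.update_of_ne (ne_of_mem_erase hx),
      Function.update_of_ne (ne_of_mem_erase hu)]
  have hold : ∑ u, f c v u = ∑ u ∈ G.neighborFinset v, W (c u) (c v) := by
    simp only [f, G.neighborFinset_eq_filter, sum_filter]
  have hnew : ∑ u, f (Function.update c v i) v u = ∑ u ∈ G.neighborFinset v, W (c u) i := by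
    simp only [f, G.neighborFinset_eq_filter, sum_filter]
    refine sum_congr rfl fun u _ => ?_
    split_ifs with h
    · rw [Function.update_self, Function.update_of_ne h.ne']
    · rfl
  rw [hrest, hold, hnew] at hmin
  linarith

/-- If the interferences from each color sum to at most `N`, some coloring has interference at
most `Δ(G) * N / |K|` at every vertex. -/
theorem SimpleGraph.exists_coloring_card_mul_interference_le {V K : Type*} [Fintype V] [Fintype K]
    [Nonempty K] (G : SimpleGraph V) [DecidableRel G.Adj] (W : K → K → ℝ)
    (hW : ∀ i j, W i j = W j i) (N : ℝ) (hN₀ : 0 ≤ N) (hN : ∀ i, ∑ j, W i j ≤ N) :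
    ∃ c : V → K, ∀ v,
      (Fintype.card K : ℝ) * ∑ u ∈ G.neighborFinset v, W (c u) (c v) ≤ G.maxDegree * N := by
  obtain ⟨c, hc⟩ := G.exists_coloring_locally_optimal W hW
  refine ⟨c, fun v => ?_⟩
  calc (Fintype.card K : ℝ) * ∑ u ∈ G.neighborFinset v, W (c u) (c v)
      = ∑ _i : K, ∑ u ∈ G.neighborFinset v, W (c u) (c v) := by simp
    _ ≤ ∑ i : K, ∑ u ∈ G.neighborFinset v, W (c u) i := sum_le_sum fun i _ => hc v i
    _ = ∑ u ∈ G.neighborFinset v, ∑ i : K, W (c u) i := sum_comm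
    _ ≤ ∑ _u ∈ G.neighborFinset v, N := sum_le_sum fun u _ => hN (c u)
    _ = G.degree v * N := by simp
    _ ≤ G.maxDegree * N := by
      gcongr
      exact G.degree_le_maxDegree v

/-- Chromatic Spectrum Coloring bound, non-multiple threshold case: the threshold `t` is
replaced by `d·⌊t/d⌋`, the nearest multiple of `d` below `t`. -/
theorem CSC_upper_bound_floor {V : Type*} [Fintype V] (G : SimpleGraph V)
    [DecidableRel G.Adj] (s : ℕ) (hs : 2 ≤ s) (W : Fin s → Fin s → ℝ)
    (hsymm : ∀ i j, W i j = W j i) (hnonneg : ∀ i j, 0 ≤ W i j)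
    (normW : ℝ) (hnormW : IsGreatest (Set.range fun i : Fin s => ∑ j, W i j) normW)
    (d : ℝ) (hd : 0 < d) (hdvd : ∀ i j, ∃ m : ℤ, W i j = m * d)
    (t : ℝ) (ht0 : 0 ≤ t)
    (ht : ((G.maxDegree : ℝ) * normW - d * ((s : ℝ) - 1)) / (s : ℝ) ≤ d * ⌊t / d⌋) :
    ⌈((G.maxDegree : ℝ) * normW + d) / (d * ⌊t / d⌋ + d)⌉ ≤ (s : ℤ) ∧
    ∃ c : V → Fin s,
      (∀ v : V, ((c v : ℕ) : ℤ) < ⌈((G.maxDegree : ℝ) * normW + d) / (d * ⌊t / d⌋ + d)⌉) ∧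
      ∀ v : V, ∑ u ∈ G.neighborFinset v, W (c u) (c v) ≤ t := by
  obtain ⟨⟨i₀, hi₀⟩, hmax⟩ := hnormW
  have hN : ∀ i, ∑ j, W i j ≤ normW := fun i => hmax ⟨i, rfl⟩
  have hN₀ : 0 ≤ normW := hi₀ ▸ sum_nonneg fun j _ => hnonneg i₀ j
  have hfloor : (0 : ℝ) ≤ ⌊t / d⌋ := by exact_mod_cast Int.floor_nonneg.2 (by positivity)
  have hpos : 0 < d * ⌊t / d⌋ + d := by positivity
  have hle : ⌈((G.maxDegree : ℝ) * normW + d) / (d * ⌊t / d⌋ + d)⌉ ≤ (s : ℤ) := by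
    have hs₀ : (0 : ℝ) < s := by positivity
    rw [div_le_iff₀ hs₀] at ht
    rw [Int.ceil_le, div_le_iff₀ hpos]
    push_cast
    linarith
  refine ⟨hle, ?_⟩
  obtain ⟨k, hk⟩ := Int.eq_ofNat_of_zero_le
    (Int.ceil_nonneg (by positivity : 0 ≤ ((G.maxDegree : ℝ) * normW + d) / (d * ⌊t / d⌋ + d)))
  have hkpos : 0 < k := by
    have : 0 < ⌈((G.maxDegree : ℝ) * normW + d) / (d * ⌊t / d⌋ + d)⌉ :=
      Int.ceil_pos.2 (by positivity)
    omega
  have hkge : (G.maxDegree : ℝ) * normW + d ≤ k * (d * ⌊t / d⌋ + d) := by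
    rw [← div_le_iff₀ hpos]
    exact_mod_cast Int.ceil_le.1 hk.le
  rw [hk] at hle ⊢
  have hks : k ≤ s := by exact_mod_cast hle
  have : Nonempty (Fin k) := ⟨⟨0, hkpos⟩⟩
  let e := Fin.castLEEmb hks
  obtain ⟨c, hc⟩ := G.exists_coloring_card_mul_interference_le (fun i j => W (e i) (e j))
    (fun i j => hsymm _ _) normW hN₀ fun i => by
      refine le_trans ?_ (hN (e i))
      rw [← sum_map univ e fun j => W (e i) j]
      exact sum_le_sum_of_subset_of_nonneg (subset_univ _) fun j _ _ => hnonneg _ j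
  refine ⟨fun v => e (c v), fun v => by exact_mod_cast (c v).isLt, fun v => ?_⟩
  choose m hm using hdvd
  have hv := hc v
  have hI : ∑ u ∈ G.neighborFinset v, W (e (c u)) (e (c v)) =
      (∑ u ∈ G.neighborFinset v, m (e (c u)) (e (c v)) : ℤ) * d := by
    push_cast
    rw [sum_mul]
    exact sum_congr rfl fun u _ => hm _ _
  rw [Fintype.card_fin] at hv
  rw [hI] at hv ⊢
  set M := ∑ u ∈ G.neighborFinset v, m (e (c u)) (e (c v))
  have hlt : (M : ℝ) * d < (⌊t / d⌋ + 1 : ℝ) * d := by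
    refine lt_of_mul_lt_mul_left ?_ (Nat.cast_nonneg (α := ℝ) k)
    linarith
  have hM : M ≤ ⌊t / d⌋ := by
    have := lt_of_mul_lt_mul_right hlt hd.le
    exact Int.lt_add_one_iff.1 (by exact_mod_cast this)
  exact (le_div_iff₀ hd).1 (Int.le_floor.1 hM)
end
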